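/- A lightcone framed curve (γ,ℓ⁺,ℓ⁻) : I → ℝ³₁ × Δ₄ with lightcone curvature (κ₁,κ₂,κ₃,α,β) is an (ℓ̃⁺,ℓ̄⁻)-Bertrand lightcone framed curve if and only if there exist smooth functions λ, k : I → ℝ with λ ≢ 0 such that k(t)(α(t)+β(t)) + α(t) − β(t) + λ(t)(κ₁(t)+κ₂(t)−κ₃(t)) = 0 for all t ∈ I; consequently, (γ,ℓ⁺,ℓ⁻) is an (ℓ̃⁺,ℓ̄⁺)-Bertrand lightcone framed curve if and only if it is an (ℓ̃⁺,ℓ̄⁻)-Bertrand lightcone framed curve. -/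

import Mathlib

open Matrix

noncomputable section

/-- The Minkowski pseudo-scalar product on `ℝ³`:
`⟨x,y⟩ = −x₁y₁ + x₂y₂ + x₃y₃`. -/
def mdot (x y : Fin 3 → ℝ) : ℝ := -(x 0 * y 0) + x 1 * y 1 + x 2 * y 2

/-- The pseudo vector product `x ∧ y` on Minkowski `ℝ³`, i.e. the determinant of the
matrix with rows `(−e₁, e₂, e₃)`, `x`, `y`. -/
def mcross (x y : Fin 3 → ℝ) : Fin 3 → ℝ :=
  ![-(x 1 * y 2 - x 2 * y 1), x 2 * y 0 - x 0 * y 2, x 0 * y 1 - x 1 * y 0]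

/-- The (punctured) lightcone `LC* = {x ≠ 0 : ⟨x,x⟩ = 0}`. -/
def LCstar (x : Fin 3 → ℝ) : Prop := x ≠ 0 ∧ mdot x x = 0

/-- Membership in `Δ₄ = {(v,w) ∈ LC* × LC* : ⟨v,w⟩ = −2}`. -/
def MemDelta4 (v w : Fin 3 → ℝ) : Prop := LCstar v ∧ LCstar w ∧ mdot v w = -2

/-- `n(t) = −(1/2) ℓ⁺(t) ∧ ℓ⁻(t)`. -/
def lcn (lp lm : ℝ → Fin 3 → ℝ) : ℝ → Fin 3 → ℝ :=
  fun t => (-(1/2) : ℝ) • mcross (lp t) (lm t)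

/-- Smoothness (on `I`) of a real valued function. -/
def Smooth1 (I : Set ℝ) (f : ℝ → ℝ) : Prop := ContDiffOn ℝ (⊤ : ℕ∞) f I

/-- Smoothness (on `I`) of an `ℝ³`-valued function. -/
def Smooth3 (I : Set ℝ) (f : ℝ → Fin 3 → ℝ) : Prop := ContDiffOn ℝ (⊤ : ℕ∞) f I

/-- `λ ≢ 0` : the set where `λ` is non-zero is dense in `I`. -/
def NotIdentZero (I : Set ℝ) (f : ℝ → ℝ) : Prop :=
  I ⊆ closure {t | t ∈ I ∧ f t ≠ 0}

/-- A lightcone framed curve `(γ, ℓ⁺, ℓ⁻) : I → ℝ³₁ × Δ₄`. -/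
structure IsLightconeFramedCurve (I : Set ℝ) (γ lp lm : ℝ → Fin 3 → ℝ) : Prop where
  smooth_base : Smooth3 I γ
  smooth_lp : Smooth3 I lp
  smooth_lm : Smooth3 I lm
  delta4 : ∀ t ∈ I, MemDelta4 (lp t) (lm t)
  exists_coeffs : ∃ α β : ℝ → ℝ, Smooth1 I α ∧ Smooth1 I β ∧
    ∀ t ∈ I, deriv γ t = α t • lp t + β t • lm t

/-- `(κ₁, κ₂, κ₃, α, β)` is the lightcone curvature of the lightcone framed curve
`(γ, ℓ⁺, ℓ⁻)`. -/
structure HasLightconeCurvature (I : Set ℝ) (γ lp lm : ℝ → Fin 3 → ℝ)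
    (κ₁ κ₂ κ₃ α β : ℝ → ℝ) : Prop where
  smooth_κ₁ : Smooth1 I κ₁
  smooth_κ₂ : Smooth1 I κ₂
  smooth_κ₃ : Smooth1 I κ₃
  smooth_α : Smooth1 I α
  smooth_β : Smooth1 I β
  deriv_lp : ∀ t ∈ I, deriv lp t = κ₁ t • lp t + (2 * κ₃ t) • lcn lp lm t
  deriv_lm : ∀ t ∈ I, deriv lm t = (-κ₁ t) • lm t + (2 * κ₂ t) • lcn lp lm t
  deriv_n : ∀ t ∈ I, deriv (lcn lp lm) t = κ₂ t • lp t + κ₃ t • lm t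
  deriv_base : ∀ t ∈ I, deriv γ t = α t • lp t + β t • lm t

/-- The vector field `ℓ⁺` built from a lightcone frame. -/
def fieldLp (lp lm : ℝ → Fin 3 → ℝ) : ℝ → Fin 3 → ℝ := fun t => lp t
/-- The vector field `ℓ⁻` built from a lightcone frame. -/
def fieldLm (lp lm : ℝ → Fin 3 → ℝ) : ℝ → Fin 3 → ℝ := fun t => lm t
/-- `nᵀ = (ℓ⁺ + ℓ⁻)/2`. -/
def fieldNT (lp lm : ℝ → Fin 3 → ℝ) : ℝ → Fin 3 → ℝ := fun t => (1/2 : ℝ) • (lp t + lm t)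
/-- `nˢ = (ℓ⁺ − ℓ⁻)/2`. -/
def fieldNS (lp lm : ℝ → Fin 3 → ℝ) : ℝ → Fin 3 → ℝ := fun t => (1/2 : ℝ) • (lp t - lm t)
/-- `n = −(1/2) ℓ⁺ ∧ ℓ⁻`. -/
def fieldN (lp lm : ℝ → Fin 3 → ℝ) : ℝ → Fin 3 → ℝ := lcn lp lm
/-- `ℓ̃⁺ = nᵀ + n`. -/
def fieldLtp (lp lm : ℝ → Fin 3 → ℝ) : ℝ → Fin 3 → ℝ :=
  fun t => fieldNT lp lm t + fieldN lp lm t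
/-- `ℓ̃⁻ = nᵀ − n`. -/
def fieldLtm (lp lm : ℝ → Fin 3 → ℝ) : ℝ → Fin 3 → ℝ :=
  fun t => fieldNT lp lm t - fieldN lp lm t

/-- `(γ,ℓ⁺,ℓ⁻)` and `(γ̄,ℓ̄⁺,ℓ̄⁻)` are `(v,w̄)`-mates. -/
def AreMates (I : Set ℝ)
    (v w : (ℝ → Fin 3 → ℝ) → (ℝ → Fin 3 → ℝ) → ℝ → Fin 3 → ℝ)
    (γ lp lm γ' lp' lm' : ℝ → Fin 3 → ℝ) : Prop :=
  IsLightconeFramedCurve I γ lp lm ∧ IsLightconeFramedCurve I γ' lp' lm' ∧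
  ∃ lam : ℝ → ℝ, Smooth1 I lam ∧ NotIdentZero I lam ∧
    (∀ t ∈ I, γ' t = γ t + lam t • v lp lm t) ∧
    (∀ t ∈ I, v lp lm t = w lp' lm' t)

/-- `(γ,ℓ⁺,ℓ⁻)` is a `(v,w̄)`-Bertrand lightcone framed curve. -/
def IsBertrand (I : Set ℝ)
    (v w : (ℝ → Fin 3 → ℝ) → (ℝ → Fin 3 → ℝ) → ℝ → Fin 3 → ℝ)
    (γ lp lm : ℝ → Fin 3 → ℝ) : Prop :=
  ∃ γ' lp' lm' : ℝ → Fin 3 → ℝ, AreMates I v w γ lp lm γ' lp' lm'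

theorem mdot_comm (x y : Fin 3 → ℝ) : mdot x y = mdot y x := by
  simp only [mdot]; ring

theorem mdot_add_left (x y z : Fin 3 → ℝ) : mdot (x + y) z = mdot x z + mdot y z := by
  simp only [mdot, Pi.add_apply]; ring

theorem mdot_sub_left (x y z : Fin 3 → ℝ) : mdot (x - y) z = mdot x z - mdot y z := by
  simp only [mdot, Pi.sub_apply]; ring

theorem mdot_smul_left (a : ℝ) (x y : Fin 3 → ℝ) : mdot (a • x) y = a * mdot x y := by
  simp only [mdot, Pi.smul_apply, smul_eq_mul]; ring

theorem mdot_add_right (x y z : Fin 3 → ℝ) : mdot x (y + z) = mdot x y + mdot x z := by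
  simp only [mdot, Pi.add_apply]; ring

theorem mdot_sub_right (x y z : Fin 3 → ℝ) : mdot x (y - z) = mdot x y - mdot x z := by
  simp only [mdot, Pi.sub_apply]; ring

theorem mdot_smul_right (a : ℝ) (x y : Fin 3 → ℝ) : mdot x (a • y) = a * mdot x y := by
  simp only [mdot, Pi.smul_apply, smul_eq_mul]; ring

theorem memDelta4_of_mdot {v w : Fin 3 → ℝ} (hv : mdot v v = 0) (hw : mdot w w = 0)
    (hvw : mdot v w = -2) : MemDelta4 v w := by
  refine ⟨⟨?_, hv⟩, ⟨?_, hw⟩, hvw⟩ <;> rintro rfl <;> simp [mdot] at hvw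

theorem MemDelta4.symm {v w : Fin 3 → ℝ} (h : MemDelta4 v w) : MemDelta4 w v :=
  ⟨h.2.1, h.1, by rw [mdot_comm, h.2.2]⟩

theorem IsLightconeFramedCurve.symm {I : Set ℝ} {γ lp lm : ℝ → Fin 3 → ℝ}
    (h : IsLightconeFramedCurve I γ lp lm) : IsLightconeFramedCurve I γ lm lp := by
  obtain ⟨α, β, hα, hβ, hd⟩ := h.exists_coeffs
  exact ⟨h.smooth_base, h.smooth_lm, h.smooth_lp, fun t ht => (h.delta4 t ht).symm,
    β, α, hβ, hα, fun t ht => by rw [hd t ht, add_comm]⟩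

theorem isBertrand_fieldLp_iff_fieldLm {I : Set ℝ}
    {v : (ℝ → Fin 3 → ℝ) → (ℝ → Fin 3 → ℝ) → ℝ → Fin 3 → ℝ} {γ lp lm : ℝ → Fin 3 → ℝ} :
    IsBertrand I v fieldLp γ lp lm ↔ IsBertrand I v fieldLm γ lp lm :=
  ⟨fun ⟨γ', lp', lm', h, h', hlam⟩ => ⟨γ', lm', lp', h, h'.symm, hlam⟩,
    fun ⟨γ', lp', lm', h, h', hlam⟩ => ⟨γ', lm', lp', h, h'.symm, hlam⟩⟩

theorem mdot_lcn_lp (lp lm : ℝ → Fin 3 → ℝ) (t : ℝ) : mdot (lcn lp lm t) (lp t) = 0 := by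
  simp [lcn, mcross, mdot]; ring

theorem mdot_lcn_lm (lp lm : ℝ → Fin 3 → ℝ) (t : ℝ) : mdot (lcn lp lm t) (lm t) = 0 := by
  simp [lcn, mcross, mdot]; ring

theorem mdot_lcn_self {lp lm : ℝ → Fin 3 → ℝ} {t : ℝ} (h : MemDelta4 (lp t) (lm t)) :
    mdot (lcn lp lm t) (lcn lp lm t) = 1 := by
  have key : mdot (lcn lp lm t) (lcn lp lm t) =
      1 / 4 * (mdot (lp t) (lm t) ^ 2 - mdot (lp t) (lp t) * mdot (lm t) (lm t)) := by
    simp [lcn, mcross, mdot]; ring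
  rw [key, h.1.2, h.2.1.2, h.2.2]; norm_num

theorem smooth1_mdot {I : Set ℝ} {f g : ℝ → Fin 3 → ℝ} (hf : Smooth3 I f) (hg : Smooth3 I g) :
    Smooth1 I fun t => mdot (f t) (g t) := by
  have hf' := contDiffOn_pi.1 hf
  have hg' := contDiffOn_pi.1 hg
  exact (((hf' 0).mul (hg' 0)).neg.add ((hf' 1).mul (hg' 1))).add ((hf' 2).mul (hg' 2))

theorem smooth3_lcn {I : Set ℝ} {lp lm : ℝ → Fin 3 → ℝ} (hp : Smooth3 I lp)
    (hm : Smooth3 I lm) : Smooth3 I (lcn lp lm) := by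
  have hp' := contDiffOn_pi.1 hp
  have hm' := contDiffOn_pi.1 hm
  refine ContDiffOn.const_smul _ (contDiffOn_pi.2 fun i => ?_)
  fin_cases i
  · exact (((hp' 1).mul (hm' 2)).sub ((hp' 2).mul (hm' 1))).neg
  · exact ((hp' 2).mul (hm' 0)).sub ((hp' 0).mul (hm' 2))
  · exact ((hp' 0).mul (hm' 1)).sub ((hp' 1).mul (hm' 0))

section Frame

variable {I : Set ℝ} {γ lp lm : ℝ → Fin 3 → ℝ}

theorem smooth3_fieldNT (hF : IsLightconeFramedCurve I γ lp lm) :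
    Smooth3 I (fieldNT lp lm) :=
  (hF.smooth_lp.add hF.smooth_lm).const_smul _

theorem smooth3_fieldNS (hF : IsLightconeFramedCurve I γ lp lm) :
    Smooth3 I (fieldNS lp lm) :=
  (hF.smooth_lp.sub hF.smooth_lm).const_smul _

theorem smooth3_fieldLtp (hF : IsLightconeFramedCurve I γ lp lm) :
    Smooth3 I (fieldLtp lp lm) :=
  (smooth3_fieldNT hF).add (smooth3_lcn hF.smooth_lp hF.smooth_lm)

theorem smooth3_fieldLtm (hF : IsLightconeFramedCurve I γ lp lm) :
    Smooth3 I (fieldLtm lp lm) :=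
  (smooth3_fieldNT hF).sub (smooth3_lcn hF.smooth_lp hF.smooth_lm)

theorem Smooth3.hasDerivAt {f : ℝ → Fin 3 → ℝ} (hf : Smooth3 I f) (hIo : IsOpen I) {t : ℝ}
    (ht : t ∈ I) : HasDerivAt f (deriv f t) t :=
  ((hf.contDiffAt (hIo.mem_nhds ht)).differentiableAt (by simp)).hasDerivAt

theorem Smooth1.hasDerivAt {f : ℝ → ℝ} (hf : Smooth1 I f) (hIo : IsOpen I) {t : ℝ}
    (ht : t ∈ I) : HasDerivAt f (deriv f t) t :=
  ((hf.contDiffAt (hIo.mem_nhds ht)).differentiableAt (by simp)).hasDerivAt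

/-- The Gram matrix of the pseudo-orthogonal frame `(ℓ̃⁺, ℓ̃⁻, nˢ)`. -/
theorem mdot_tilde_frame {t : ℝ} (h : MemDelta4 (lp t) (lm t)) :
    mdot (fieldLtp lp lm t) (fieldLtp lp lm t) = 0 ∧
    mdot (fieldLtm lp lm t) (fieldLtm lp lm t) = 0 ∧
    mdot (fieldNS lp lm t) (fieldNS lp lm t) = 1 ∧
    mdot (fieldLtm lp lm t) (fieldLtp lp lm t) = -2 ∧
    mdot (fieldNS lp lm t) (fieldLtp lp lm t) = 0 ∧
    mdot (fieldNS lp lm t) (fieldLtm lp lm t) = 0 := by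
  have h1 := mdot_lcn_lp lp lm t
  have h2 := mdot_lcn_lm lp lm t
  have h3 := mdot_lcn_self h
  have h4 := h.symm.2.2
  have h5 := (mdot_comm _ _).trans h1
  have h6 := (mdot_comm _ _).trans h2
  simp only [fieldLtp, fieldLtm, fieldNS, fieldNT, fieldN, mdot_add_left, mdot_sub_left,
    mdot_smul_left, mdot_add_right, mdot_sub_right, mdot_smul_right, h1, h2, h3, h4, h5, h6,
    h.1.2, h.2.1.2, h.2.2]
  norm_num

/-- The velocity of `γ + λ ℓ̃⁺` in the frame `(ℓ̃⁺, ℓ̃⁻, nˢ)`. -/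
theorem hasDerivAt_add_smul_fieldLtp (hIo : IsOpen I) {κ₁ κ₂ κ₃ α β lam : ℝ → ℝ}
    (hF : IsLightconeFramedCurve I γ lp lm)
    (hC : HasLightconeCurvature I γ lp lm κ₁ κ₂ κ₃ α β) (hlam : Smooth1 I lam)
    {t : ℝ} (ht : t ∈ I) :
    HasDerivAt (fun s => γ s + lam s • fieldLtp lp lm s)
      (((α t + β t) / 2 + deriv lam t + lam t * (κ₂ t + κ₃ t)) • fieldLtp lp lm t +
        ((α t + β t) / 2) • fieldLtm lp lm t +
        (α t - β t + lam t * (κ₁ t + κ₂ t - κ₃ t)) • fieldNS lp lm t) t := by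
  have hγ := hF.smooth_base.hasDerivAt hIo ht
  have hp := Smooth3.hasDerivAt hF.smooth_lp hIo ht
  have hm := Smooth3.hasDerivAt hF.smooth_lm hIo ht
  have hn := Smooth3.hasDerivAt (smooth3_lcn hF.smooth_lp hF.smooth_lm) hIo ht
  have hL : HasDerivAt (fieldLtp lp lm) _ t := ((hp.add hm).const_smul (1 / 2 : ℝ)).add hn
  refine (hγ.add ((hlam.hasDerivAt hIo ht).smul hL)).congr_deriv ?_
  rw [hC.deriv_base t ht, hC.deriv_lp t ht, hC.deriv_lm t ht, hC.deriv_n t ht]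
  simp only [fieldLtp, fieldLtm, fieldNS, fieldNT, fieldN]
  module

theorem exists_coeff_of_isBertrand (hIo : IsOpen I) {κ₁ κ₂ κ₃ α β : ℝ → ℝ}
    (hF : IsLightconeFramedCurve I γ lp lm)
    (hC : HasLightconeCurvature I γ lp lm κ₁ κ₂ κ₃ α β)
    (h : IsBertrand I fieldLtp fieldLm γ lp lm) :
    ∃ lam k : ℝ → ℝ, Smooth1 I lam ∧ Smooth1 I k ∧ NotIdentZero I lam ∧
      ∀ t ∈ I, k t * (α t + β t) + α t - β t + lam t * (κ₁ t + κ₂ t - κ₃ t) = 0 := by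
  obtain ⟨γ', lp', lm', -, hF', lam, hlam, hlam0, hγ', hv⟩ := h
  obtain ⟨a, b, -, -, hab⟩ := hF'.exists_coeffs
  refine ⟨lam, fun t => -(1 / 2) * mdot (lp' t) (fieldNS lp lm t), hlam,
    contDiffOn_const.mul (smooth1_mdot hF'.smooth_lp (smooth3_fieldNS hF)), hlam0,
    fun t ht => ?_⟩
  obtain ⟨h1, -, h3, h4, h5, h6⟩ := mdot_tilde_frame (hF.delta4 t ht)
  have hD := ((hasDerivAt_add_smul_fieldLtp hIo hF hC hlam ht).congr_of_eventuallyEq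
    (Filter.eventuallyEq_of_mem (hIo.mem_nhds ht) hγ')).deriv
  have hlm : lm' t = fieldLtp lp lm t := (hv t ht).symm
  have hPL := (hF'.delta4 t ht).2.2
  rw [hab t ht, hlm] at hD
  rw [hlm] at hPL
  have e1 := congrArg (fun x => mdot x (fieldLtp lp lm t)) hD
  have e2 := congrArg (fun x => mdot x (fieldNS lp lm t)) hD
  simp only [mdot_add_left, mdot_smul_left, h1, h3, h4, h5, hPL,
    (mdot_comm _ _).trans h5, (mdot_comm _ _).trans h6] at e1 e2
  linear_combination (-1 / 2 * mdot (lp' t) (fieldNS lp lm t)) * e1 - e2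

theorem isBertrand_of_exists_coeff (hIo : IsOpen I) {κ₁ κ₂ κ₃ α β lam k : ℝ → ℝ}
    (hF : IsLightconeFramedCurve I γ lp lm)
    (hC : HasLightconeCurvature I γ lp lm κ₁ κ₂ κ₃ α β)
    (hlam : Smooth1 I lam) (hk : Smooth1 I k) (hlam0 : NotIdentZero I lam)
    (heq : ∀ t ∈ I, k t * (α t + β t) + α t - β t +
      lam t * (κ₁ t + κ₂ t - κ₃ t) = 0) :
    IsBertrand I fieldLtp fieldLm γ lp lm := by
  have hL := smooth3_fieldLtp hF
  have hab : Smooth1 I fun t => (α t + β t) / 2 := (hC.smooth_α.add hC.smooth_β).div_const 2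
  have hlam' : Smooth1 I (deriv lam) := hlam.deriv_of_isOpen hIo (by simp)
  refine ⟨fun t => γ t + lam t • fieldLtp lp lm t,
    fun t => fieldLtm lp lm t - (2 * k t) • fieldNS lp lm t + (k t ^ 2) • fieldLtp lp lm t,
    fieldLtp lp lm, hF,
    ⟨hF.smooth_base.add (hlam.smul hL), ?_, hL, fun t ht => ?_,
      fun t => (α t + β t) / 2,
      fun t => (α t + β t) / 2 * (1 - k t ^ 2) + deriv lam t + lam t * (κ₂ t + κ₃ t),
      hab, ?_, fun t ht => ?_⟩,
    lam, hlam, hlam0, fun _ _ => rfl, fun _ _ => rfl⟩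
  · exact ((smooth3_fieldLtm hF).sub ((contDiffOn_const.mul hk).smul (smooth3_fieldNS hF))).add
      ((hk.pow 2).smul hL)
  · obtain ⟨h1, h2, h3, h4, h5, h6⟩ := mdot_tilde_frame (hF.delta4 t ht)
    refine memDelta4_of_mdot ?_ h1 ?_ <;>
      simp only [mdot_add_left, mdot_sub_left, mdot_smul_left, mdot_add_right, mdot_sub_right,
        mdot_smul_right, h1, h2, h3, h4, h5, h6, (mdot_comm _ _).trans h4,
        (mdot_comm _ _).trans h5, (mdot_comm _ _).trans h6] <;> ring
  · exact ((hab.mul (contDiffOn_const.sub (hk.pow 2))).add hlam').add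
      (hlam.mul (hC.smooth_κ₂.add hC.smooth_κ₃))
  · have hc : α t - β t + lam t * (κ₁ t + κ₂ t - κ₃ t) = -(k t * (α t + β t)) := by
      linear_combination heq t ht
    rw [(hasDerivAt_add_smul_fieldLtp hIo hF hC hlam ht).deriv, hc]
    module

end Frame

/-- `(ℓ̃⁺,ℓ̄⁻)`-Bertrand lightcone framed curves: existence condition, and equivalence with
the `(ℓ̃⁺,ℓ̄⁺)`-Bertrand condition. -/
theorem bertrand_ltp_lmbar
    (I : Set ℝ) (hIo : IsOpen I) (hIc : I.OrdConnected)
    (γ lp lm : ℝ → Fin 3 → ℝ) (κ₁ κ₂ κ₃ α β : ℝ → ℝ)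
    (hF : IsLightconeFramedCurve I γ lp lm)
    (hC : HasLightconeCurvature I γ lp lm κ₁ κ₂ κ₃ α β) :
    (IsBertrand I fieldLtp fieldLm γ lp lm ↔
      ∃ lam k : ℝ → ℝ, Smooth1 I lam ∧ Smooth1 I k ∧ NotIdentZero I lam ∧
        ∀ t ∈ I, k t * (α t + β t) + α t - β t +
          lam t * (κ₁ t + κ₂ t - κ₃ t) = 0) ∧
    (IsBertrand I fieldLtp fieldLp γ lp lm ↔ IsBertrand I fieldLtp fieldLm γ lp lm) := by
  refine ⟨⟨exists_coeff_of_isBertrand hIo hF hC, ?_⟩, isBertrand_fieldLp_iff_fieldLm⟩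
  rintro ⟨lam, k, hlam, hk, hlam0, heq⟩
  exact isBertrand_of_exists_coeff hIo hF hC hlam hk hlam0 heq
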